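/- In a pre-operad C with μ ∈ C², right translations of the composition algebra are derivations of the cup-algebra: (f ⌣ g)•h = f ⌣ (g•h) + (−1)^{|h|g}(f•h) ⌣ g for all homogeneous f, g, h. -/

import Mathlib

/-- A linear pre-operad (composition system) over a commutative ring `K`:
a sequence of `K`-modules `C n` with partial compositions
`∘ᵢ : C m ⊗ C n → C (m+n-1)` (for `0 ≤ i ≤ m-1`), composition relations,
and a unit `𝕀 ∈ C 1`.  Signs `(-1)^{|f||g|}` are written with exponents of the
same parity, e.g. `(m+1)*(n+1) ≡ (m-1)*(n-1) (mod 2)`. -/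
structure PreOperad (K : Type*) [CommRing K] where
  C : ℕ → Type*
  addCommGroup : ∀ n, AddCommGroup (C n)
  module : ∀ n, letI := addCommGroup n; Module K (C n)
  comp : ∀ {m n : ℕ}, C m → ℕ → C n → C (m + n - 1)
  comp_add_left : ∀ {m n : ℕ} (i : ℕ) (g : C n),
    letI := addCommGroup m; letI := addCommGroup (m + n - 1);
    ∀ f₁ f₂ : C m, comp (f₁ + f₂) i g = comp f₁ i g + comp f₂ i g
  comp_add_right : ∀ {m n : ℕ} (f : C m) (i : ℕ),
    letI := addCommGroup n; letI := addCommGroup (m + n - 1);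
    ∀ g₁ g₂ : C n, comp f i (g₁ + g₂) = comp f i g₁ + comp f i g₂
  comp_smul_left : ∀ {m n : ℕ} (a : K) (i : ℕ) (g : C n),
    letI := addCommGroup m; letI := module m;
    letI := addCommGroup (m + n - 1); letI := module (m + n - 1);
    ∀ f : C m, comp (a • f) i g = a • comp f i g
  comp_smul_right : ∀ {m n : ℕ} (f : C m) (i : ℕ) (a : K),
    letI := addCommGroup n; letI := module n;
    letI := addCommGroup (m + n - 1); letI := module (m + n - 1);
    ∀ g : C n, comp f i (a • g) = a • comp f i g
  unit : C 1
  unit_comp : ∀ {n : ℕ} (f : C n),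
    (show 1 + n - 1 = n by omega) ▸ comp unit 0 f = f
  comp_unit : ∀ {n : ℕ} (f : C n) (i : ℕ), i < n → comp f i unit = f
  /-- `(h∘ᵢf)∘ⱼg = (-1)^{|f||g|}(h∘ⱼg)∘_{i+|g|}f` for `0 ≤ j ≤ i-1`. -/
  assoc₁ : ∀ {p m n : ℕ} (h : C p) (f : C m) (g : C n) (i j : ℕ)
    (h₁ : j < i) (h₂ : i < p) (h₃ : 1 ≤ n),
    letI := addCommGroup ((p + n - 1) + m - 1);
    comp (comp h i f) j g =
      (show (p + n - 1) + m - 1 = (p + m - 1) + n - 1 by omega) ▸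
        (((-1 : ℤ) ^ ((m + 1) * (n + 1))) • comp (comp h j g) (i + n - 1) f)
  /-- `(h∘ᵢf)∘ⱼg = h∘ᵢ(f∘_{j-i}g)` for `i ≤ j ≤ i+|f|`. -/
  assoc₂ : ∀ {p m n : ℕ} (h : C p) (f : C m) (g : C n) (i j : ℕ)
    (h₁ : i < p) (h₂ : 1 ≤ m) (h₃ : i ≤ j) (h₄ : j ≤ i + m - 1),
    comp (comp h i f) j g =
      (show p + (m + n - 1) - 1 = (p + m - 1) + n - 1 by omega) ▸
        comp h i (comp f (j - i) g)
  /-- `(h∘ᵢf)∘ⱼg = (-1)^{|f||g|}(h∘_{j-|f|}g)∘ᵢf` for `i+f ≤ j ≤ |h|+|f|`. -/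
  assoc₃ : ∀ {p m n : ℕ} (h : C p) (f : C m) (g : C n) (i j : ℕ)
    (h₁ : i < p) (h₂ : 1 ≤ m) (h₃ : i + m ≤ j) (h₄ : j ≤ (p - 1) + (m - 1)),
    letI := addCommGroup ((p + n - 1) + m - 1);
    comp (comp h i f) j g =
      (show (p + n - 1) + m - 1 = (p + m - 1) + n - 1 by omega) ▸
        (((-1 : ℤ) ^ ((m + 1) * (n + 1))) • comp (comp h (j - (m - 1)) g) i f)

attribute [instance] PreOperad.addCommGroup PreOperad.module

namespace PreOperad

variable {K : Type*} [CommRing K] (o : PreOperad K)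

/-- Transport along an equality of degrees. -/
def nCast {m n : ℕ} (h : m = n) (x : o.C m) : o.C n := h ▸ x

/-- Total composition `f•g := Σ_{i=0}^{|f|} f∘ᵢg`. -/
def tot {m n : ℕ} (f : o.C m) (g : o.C n) : o.C (m + n - 1) :=
  ∑ i ∈ Finset.range m, o.comp f i g

/-- Cup multiplication `f ⌣ g := (-1)^f (μ∘₀f)∘_f g`. -/
def cup (μ : o.C 2) {m n : ℕ} (f : o.C m) (g : o.C n) : o.C (m + n) :=
  ((-1 : ℤ) ^ m) •
    o.nCast (by omega)
      (o.comp (o.nCast (show 2 + m - 1 = m + 1 by omega) (o.comp μ 0 f)) m g)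

/-- Graded commutator `[f,g] := f•g - (-1)^{|f||g|} g•f`. -/
def bracket {m n : ℕ} (f : o.C m) (g : o.C n) : o.C (m + n - 1) :=
  o.tot f g - ((-1 : ℤ) ^ ((m + 1) * (n + 1))) • o.nCast (by omega) (o.tot g f)

/-- Gerstenhaber tribraces `{h,f,g} := Σ_{i=0}^{|h|-1} Σ_{j=i+f}^{|f|+|h|} (h∘ᵢf)∘ⱼg`. -/
def tribrace {p m n : ℕ} (h : o.C p) (f : o.C m) (g : o.C n) :
    o.C ((p + m - 1) + n - 1) :=
  ∑ i ∈ Finset.range (p - 1), ∑ j ∈ Finset.Icc (i + m) ((m - 1) + (p - 1)),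
    o.comp (o.comp h i f) j g

/-- Tetrabraces `{h,f,g,b}`. -/
def tetrabrace {p m n q : ℕ} (h : o.C p) (f : o.C m) (g : o.C n) (b : o.C q) :
    o.C (((p + m - 1) + n - 1) + q - 1) :=
  ∑ i ∈ Finset.range (p - 2), ∑ j ∈ Finset.Icc (i + m) ((p - 1) + (m - 1) - 1),
    ∑ k ∈ Finset.Icc (j + n) ((p - 1) + (m - 1) + (n - 1)),
      o.comp (o.comp (o.comp h i f) j g) k b

/-- Pre-coboundary operator `δf := -[f,μ] = -(f•μ - (-1)^{|f|} μ•f)`. -/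
def delta (μ : o.C 2) {m : ℕ} (f : o.C m) : o.C (m + 1) :=
  -(o.tot f μ) + ((-1 : ℤ) ^ (m + 1)) • o.nCast (by omega) (o.tot μ f)

end PreOperad

namespace PreOperad
variable {K : Type*} [CommRing K] (o : PreOperad K)

theorem nCast_nCast {a b c : ℕ} (h : a = b) (h' : b = c) (x : o.C a) :
    o.nCast h' (o.nCast h x) = o.nCast (h.trans h') x := by
  subst h; subst h'; rfl

/-- Transport along an equality of degrees, as an additive map. -/
def nCastHom {a b : ℕ} (h : a = b) : o.C a →+ o.C b where
  toFun := o.nCast h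
  map_zero' := by subst h; rfl
  map_add' _ _ := by subst h; rfl

theorem nCast_zsmul {a b : ℕ} (h : a = b) (z : ℤ) (x : o.C a) :
    o.nCast h (z • x) = z • o.nCast h x :=
  map_zsmul (o.nCastHom h) z x

theorem nCast_sum {ι : Type*} {a b : ℕ} (h : a = b) (s : Finset ι) (x : ι → o.C a) :
    o.nCast h (∑ i ∈ s, x i) = ∑ i ∈ s, o.nCast h (x i) :=
  map_sum (o.nCastHom h) x s

theorem comp_nCast_left {a b n : ℕ} (h : a = b) (x : o.C a) (i : ℕ) (g : o.C n) :
    o.comp (o.nCast h x) i g = o.nCast (by rw [h]) (o.comp x i g) := by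
  subst h; rfl

/-- Partial composition as an additive map in its left argument. -/
def compHomLeft {m n : ℕ} (i : ℕ) (g : o.C n) : o.C m →+ o.C (m + n - 1) :=
  AddMonoidHom.mk' (fun f => o.comp f i g) (o.comp_add_left i g)

/-- Partial composition as an additive map in its right argument. -/
def compHomRight {m n : ℕ} (f : o.C m) (i : ℕ) : o.C n →+ o.C (m + n - 1) :=
  AddMonoidHom.mk' (fun g => o.comp f i g) (o.comp_add_right f i)

theorem zsmul_comp {m n : ℕ} (z : ℤ) (f : o.C m) (i : ℕ) (g : o.C n) :
    o.comp (z • f) i g = z • o.comp f i g :=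
  map_zsmul (o.compHomLeft i g) z f

theorem sum_comp {ι : Type*} {m n : ℕ} (s : Finset ι) (f : ι → o.C m) (i : ℕ) (g : o.C n) :
    o.comp (∑ j ∈ s, f j) i g = ∑ j ∈ s, o.comp (f j) i g :=
  map_sum (o.compHomLeft i g) f s

theorem comp_sum {ι : Type*} {m n : ℕ} (s : Finset ι) (f : o.C m) (i : ℕ) (g : ι → o.C n) :
    o.comp f i (∑ j ∈ s, g j) = ∑ j ∈ s, o.comp f i (g j) :=
  map_sum (o.compHomRight f i) g s

theorem cup_eq (μ : o.C 2) {m n : ℕ} (f : o.C m) (g : o.C n) :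
    o.cup μ f g =
      ((-1 : ℤ) ^ m) • o.nCast (by omega) (o.comp (o.comp μ 0 f) m g) := by
  rw [cup, comp_nCast_left, nCast_nCast]

theorem sum_cup {ι : Type*} (μ : o.C 2) {m n : ℕ} (s : Finset ι) (f : ι → o.C m) (g : o.C n) :
    o.cup μ (∑ i ∈ s, f i) g = ∑ i ∈ s, o.cup μ (f i) g := by
  simp only [cup_eq, comp_sum, sum_comp, nCast_sum, Finset.smul_sum]

theorem cup_sum {ι : Type*} (μ : o.C 2) {m n : ℕ} (s : Finset ι) (f : o.C m) (g : ι → o.C n) :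
    o.cup μ f (∑ i ∈ s, g i) = ∑ i ∈ s, o.cup μ f (g i) := by
  simp only [cup_eq, comp_sum, nCast_sum, Finset.smul_sum]

/-- Inserting `h` into the left factor of a cup product. -/
theorem cup_comp_of_lt (μ : o.C 2) {m n q : ℕ} (hq : 1 ≤ q) (f : o.C m) (g : o.C n)
    (h : o.C q) {i : ℕ} (hi : i < m) :
    o.comp (o.cup μ f g) i h =
      ((-1 : ℤ) ^ ((q + 1) * n)) • o.nCast (by omega) (o.cup μ (o.comp f i h) g) := by
  have e₁ := o.assoc₁ (o.comp μ 0 f) g h m i hi (by omega) hq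
  have e₂ := o.assoc₂ μ f h 0 i (by omega) (by omega) (by omega) (by omega)
  change _ = o.nCast _ _ at e₁
  change _ = o.nCast _ _ at e₂
  rw [Nat.sub_zero] at e₂
  rw [cup_eq, cup_eq, zsmul_comp, comp_nCast_left, e₁, e₂, comp_nCast_left]
  simp only [nCast_zsmul, nCast_nCast, smul_smul]
  congr 1
  obtain ⟨r, rfl⟩ : ∃ r, q = r + 1 := ⟨q - 1, by omega⟩
  rw [← pow_add, ← pow_add, show m + (r + 1) - 1 = m + r by omega]
  rw [show m + (n + 1) * (r + 1 + 1) = (r + 1 + 1) * n + (m + r) + 2 by ring, pow_add _ _ 2]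
  norm_num

/-- Inserting `h` into the right factor of a cup product. -/
theorem cup_comp_add (μ : o.C 2) {m n q : ℕ} (hq : 1 ≤ q) (f : o.C m) (g : o.C n)
    (h : o.C q) {i : ℕ} (hi : i < n) :
    o.comp (o.cup μ f g) (m + i) h =
      o.nCast (by omega) (o.cup μ f (o.comp g i h)) := by
  have e := o.assoc₂ (o.comp μ 0 f) g h m (m + i) (by omega) (by omega) (by omega) (by omega)
  change _ = o.nCast _ _ at e
  rw [Nat.add_sub_cancel_left] at e
  rw [cup_eq, cup_eq, zsmul_comp, comp_nCast_left, e]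
  simp only [nCast_zsmul, nCast_nCast]

/-- Right translations of the composition algebra are derivations of the
cup-algebra: `(f ⌣ g)•h = f ⌣ (g•h) + (-1)^{|h|g}(f•h) ⌣ g`. -/
theorem cup_tot_right_derivation (μ : o.C 2) {m n q : ℕ} (hq : 1 ≤ q)
    (f : o.C m) (g : o.C n) (h : o.C q) :
    o.tot (o.cup μ f g) h =
      o.nCast (by omega) (o.cup μ f (o.tot g h)) +
        ((-1 : ℤ) ^ ((q + 1) * n)) • o.nCast (by omega) (o.cup μ (o.tot f h) g) := by
  simp only [tot, cup_sum, sum_cup, nCast_sum, Finset.smul_sum]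
  rw [Finset.sum_range_add]
  refine (add_comm _ _).trans (congrArg₂ _ ?_ ?_)
  · exact Finset.sum_congr rfl fun i hi =>
      o.cup_comp_add μ hq f g h (Finset.mem_range.1 hi)
  · exact Finset.sum_congr rfl fun i hi =>
      o.cup_comp_of_lt μ hq f g h (Finset.mem_range.1 hi)

end PreOperad
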